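/- Let φ : ℂ → ℂ be continuous on the closed unit disc and holomorphic on 𝔻, with φ(𝔻) ⊆ 𝔻, |φ(e^{it})| ≤ 1 for all t, and suppose the set {t ∈ [−π,π] : |φ(e^{it})| = 1} has Lebesgue measure zero. Let T = C_φ be the composition operator on ℓ². Let n ≥ 1, let B be a finite Blaschke product of degree n − 1, i.e. B(z) = z^m ∏_{j=1}^{n−1−m} (z_j − z)/(1 − \overline{z_j} z) with 0 ≤ m ≤ n − 1 and points z_j ∈ 𝔻∖{0}, and let r ∈ (0,1). Suppose K ≥ 0 satisfies (1/(2π)) ∫_{{t ∈ [−π,π] : r < |φ(e^{it})| < 1}} |f_a(φ(e^{it}))|² dt ≤ K·‖a‖²_{ℓ²} for every a ∈ ℓ². Then a_n(T) ≤ ( S²·‖T‖² + K )^{1/2}, where S := sup{ |B(φ(e^{it}))| : t ∈ [−π,π], |φ(e^{it})| ≤ r }. -/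

import Mathlib

open Complex MeasureTheory Filter Set

noncomputable section

abbrev H2 : Type := lp (fun _ : ℕ => ℂ) 2

noncomputable def fa (a : H2) (z : ℂ) : ℂ := ∑' k : ℕ, a k * z ^ k

noncomputable def approxNum (T : H2 →L[ℂ] H2) (n : ℕ) : ℝ :=
  sInf {c : ℝ | ∃ R : H2 →L[ℂ] H2,
    FiniteDimensional ℂ (LinearMap.range R.toLinearMap) ∧
    Module.finrank ℂ (LinearMap.range R.toLinearMap) ≤ n - 1 ∧ c = ‖T - R‖}

lemma h2_norm_sq (a : H2) : HasSum (fun k => ‖a k‖ ^ 2) (‖a‖ ^ 2) := by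
  have := lp.hasSum_norm (p := 2) (by norm_num) a
  simpa using this

lemma fa_summable_norm (a : H2) {z : ℂ} (hz : ‖z‖ < 1) : Summable (fun k => ‖a k * z ^ k‖) := by
  refine Summable.of_nonneg_of_le (fun _ => norm_nonneg _) (fun k => ?_)
    ((summable_geometric_of_lt_one (norm_nonneg z) hz).mul_left ‖a‖)
  rw [norm_mul, norm_pow]
  gcongr
  exact lp.norm_apply_le_norm (by norm_num) a k

lemma fa_summable (a : H2) {z : ℂ} (hz : ‖z‖ < 1) : Summable (fun k => a k * z ^ k) :=
  (fa_summable_norm a hz).of_norm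

lemma fa_sub (a b : H2) {z : ℂ} (hz : ‖z‖ < 1) : fa (a - b) z = fa a z - fa b z := by
  unfold fa
  rw [← (fa_summable a hz).tsum_sub (fa_summable b hz)]
  congr 1; ext k; simp [sub_mul]

lemma fa_smul (c : ℂ) (a : H2) (z : ℂ) : fa (c • a) z = c * fa a z := by
  unfold fa
  rw [← tsum_mul_left]
  congr 1; ext k; simp [mul_assoc]

/-- underlying sequence of the shift -/
def shiftFun (a : ℕ → ℂ) : ℕ → ℂ := fun k => Nat.casesOn k 0 a

@[simp] lemma shiftFun_zero (a : ℕ → ℂ) : shiftFun a 0 = 0 := rfl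
@[simp] lemma shiftFun_succ (a : ℕ → ℂ) (k : ℕ) : shiftFun a (k + 1) = a k := rfl

lemma shiftFun_hasSum (a : H2) : HasSum (fun k => ‖shiftFun a k‖ ^ 2) (‖a‖ ^ 2) := by
  rw [← hasSum_nat_add_iff' 1]
  simpa using h2_norm_sq a

lemma shiftFun_mem (a : H2) : Memℓp (shiftFun a) 2 := by
  rw [memℓp_gen_iff (by norm_num)]
  simpa using (shiftFun_hasSum a).summable

/-- the shift operator -/
def shiftLin : H2 →ₗ[ℂ] H2 where
  toFun a := ⟨shiftFun a, shiftFun_mem a⟩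
  map_add' a b := by
    ext k
    show shiftFun (fun j => a j + b j) k = shiftFun a k + shiftFun b k
    cases k <;> simp
  map_smul' c b := by
    ext k; cases k <;> simp

lemma shiftLin_apply (a : H2) (k : ℕ) : shiftLin a k = shiftFun a k := rfl

lemma shiftLin_norm (a : H2) : ‖shiftLin a‖ = ‖a‖ := by
  have h := (h2_norm_sq (shiftLin a)).unique (shiftFun_hasSum a)
  exact (sq_eq_sq₀ (norm_nonneg _) (norm_nonneg _)).1 h

def shiftOp : H2 →L[ℂ] H2 := shiftLin.mkContinuous 1 (fun a => by simp [shiftLin_norm])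

lemma shiftOp_apply (a : H2) (k : ℕ) : shiftOp a k = shiftFun a k := rfl

lemma shiftOp_norm (a : H2) : ‖shiftOp a‖ = ‖a‖ := shiftLin_norm a

lemma shiftOp_opNorm : ‖shiftOp‖ ≤ 1 :=
  shiftOp.opNorm_le_bound zero_le_one (fun a => by simp [shiftOp_norm])

lemma fa_shift (a : H2) {z : ℂ} (hz : ‖z‖ < 1) : fa (shiftOp a) z = z * fa a z := by
  unfold fa
  rw [(fa_summable (shiftOp a) hz).tsum_eq_zero_add, ← tsum_mul_left]
  simp only [shiftOp_apply, shiftFun_zero, shiftFun_succ, zero_mul, zero_add]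
  congr 1; ext k; ring

open ContinuousLinearMap in
/-- M is an isometric multiplication operator with symbol b and corank at most k -/
structure Good (M : H2 →L[ℂ] H2) (b : ℂ → ℂ) (k : ℕ) : Prop where
  iso : ∀ x, ‖M x‖ = ‖x‖
  mul : ∀ x z, ‖z‖ < 1 → fa (M x) z = b z * fa x z
  bdd : ∃ C : ℝ, ∀ z : ℂ, ‖z‖ < 1 → ‖b z‖ ≤ C
  rank : LinearMap.rank ((1 - M * adjoint M : H2 →L[ℂ] H2) : H2 →ₗ[ℂ] H2) ≤ (k : Cardinal)

lemma good_one : Good 1 (fun _ => 1) 0 where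
  iso x := by simp
  mul x z hz := by simp
  bdd := ⟨1, fun z hz => by simp⟩
  rank := by
    have : (1 - (1 : H2 →L[ℂ] H2) * ContinuousLinearMap.adjoint 1) = 0 := by
      rw [← ContinuousLinearMap.star_eq_adjoint]; simp
    rw [this]; simp

lemma Good.comp {M N : H2 →L[ℂ] H2} {b c : ℂ → ℂ} {k l : ℕ} (hM : Good M b k) (hN : Good N c l) :
    Good (M * N) (fun z => b z * c z) (k + l) where
  iso x := by simp [hM.iso, hN.iso]
  mul x z hz := by
    rw [mul_apply_eq_comp, hM.mul _ _ hz, hN.mul _ _ hz, mul_assoc]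
  bdd := by
    obtain ⟨C, hC⟩ := hM.bdd
    obtain ⟨D, hD⟩ := hN.bdd
    refine ⟨C * D, fun z hz => ?_⟩
    rw [norm_mul]
    exact mul_le_mul (hC z hz) (hD z hz) (norm_nonneg _) ((norm_nonneg _).trans (hC z hz))
  rank := by
    have h : (1 - (M * N) * ContinuousLinearMap.adjoint (M * N)) =
        (1 - M * ContinuousLinearMap.adjoint M) +
        M * (1 - N * ContinuousLinearMap.adjoint N) * ContinuousLinearMap.adjoint M := by
      simp only [← ContinuousLinearMap.star_eq_adjoint, star_mul]
      noncomm_ring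
    rw [h]
    refine (LinearMap.rank_add_le _ _).trans ?_
    push_cast
    refine add_le_add hM.rank ?_
    refine le_trans ?_ hN.rank
    exact (LinearMap.rank_comp_le_left _ _).trans (LinearMap.rank_comp_le_right _ _)

lemma rank_aux (M : H2 →L[ℂ] H2) (hM : ∀ x, ‖M x‖ = ‖x‖) (w : ℂ)
    (hr : ∀ y, ∃ x, M x = w • y - shiftOp y) :
    LinearMap.rank ((1 - M * ContinuousLinearMap.adjoint M : H2 →L[ℂ] H2) : H2 →ₗ[ℂ] H2)
      ≤ ((1 : ℕ) : Cardinal) := by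
  have hMM := (ContinuousLinearMap.norm_map_iff_adjoint_comp_self M).1 hM
  set P : H2 →L[ℂ] H2 := 1 - M * ContinuousLinearMap.adjoint M with hP
  have hk : ∀ x, ContinuousLinearMap.adjoint M (P x) = 0 := by
    intro x
    have := congrArg (fun f : H2 →L[ℂ] H2 => f (ContinuousLinearMap.adjoint M x)) hMM
    simp only [ContinuousLinearMap.comp_apply] at this
    simp [hP, this]
  have hrec : ∀ x (k : ℕ), (P x) (k + 1) = starRingEnd ℂ w * (P x) k := by
    intro x k
    obtain ⟨y, hy⟩ := hr (lp.single 2 k 1)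
    have h1 : inner ℂ (M y) (P x) = 0 := by
      rw [← ContinuousLinearMap.adjoint_inner_right, hk, inner_zero_right]
    have h2 : shiftOp (lp.single 2 k 1) = lp.single 2 (k + 1) (1 : ℂ) := by
      ext j
      rw [shiftOp_apply]
      cases j with
      | zero => simp
      | succ j => simp [Pi.single_apply]
    rw [hy, h2, inner_sub_left, inner_smul_left, lp.inner_single_left, lp.inner_single_left] at h1
    simp at h1
    linear_combination -h1
  let ev : H2 →ₗ[ℂ] ℂ := 
    { toFun := fun x => x 0
      map_add' := fun x y => by simp
      map_smul' := fun c x => by simp }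
  have hinj : Function.Injective (ev ∘ₗ (LinearMap.range (P : H2 →ₗ[ℂ] H2)).subtype) := by
    rw [← LinearMap.ker_eq_bot, LinearMap.ker_eq_bot']
    rintro ⟨_, x, rfl⟩ hx
    have hx0 : (P x) 0 = 0 := hx
    apply Subtype.ext
    show P x = 0
    ext k
    induction k with
    | zero => simpa using hx0
    | succ k ih => rw [hrec, ih]; simp
  have := LinearMap.rank_le_of_injective _ hinj
  simpa using this

lemma good_shift : Good shiftOp (fun z => z) 1 where
  iso := shiftOp_norm
  mul x z hz := fa_shift x hz
  bdd := ⟨1, fun z hz => hz.le⟩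
  rank := rank_aux _ shiftOp_norm 0 (fun y => ⟨-y, by simp⟩)

lemma good_blaschke (w : ℂ) (hw : ‖w‖ < 1) :
    ∃ M, Good M (fun z => (w - z) / (1 - starRingEnd ℂ w * z)) 1 := by
  have hlt : ‖starRingEnd ℂ w • shiftOp‖ < 1 := by
    rw [norm_smul, RCLike.norm_conj]
    nlinarith [norm_nonneg w, shiftOp_opNorm, norm_nonneg shiftOp]
  set u : (H2 →L[ℂ] H2)ˣ := Units.oneSub (starRingEnd ℂ w • shiftOp) hlt with hu
  have hu1 : ∀ x, (u : H2 →L[ℂ] H2) x = x - starRingEnd ℂ w • shiftOp x := by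
    intro x; simp [hu]
  set W : H2 →L[ℂ] H2 := w • 1 - shiftOp with hW
  have hW1 : ∀ x, W x = w • x - shiftOp x := by intro x; simp [hW]
  have hui : ∀ x, (u : H2 →L[ℂ] H2) ((↑u⁻¹ : H2 →L[ℂ] H2) x) = x := fun x => by
    rw [← mul_apply_eq_comp, Units.mul_inv]; rfl
  have hiu : ∀ x, (↑u⁻¹ : H2 →L[ℂ] H2) ((u : H2 →L[ℂ] H2) x) = x := fun x => by
    rw [← mul_apply_eq_comp, Units.inv_mul]; rfl
  have hiso : ∀ x, ‖W x‖ = ‖(u : H2 →L[ℂ] H2) x‖ := by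
    intro x
    refine (sq_eq_sq₀ (norm_nonneg _) (norm_nonneg _)).1 ?_
    rw [hu1, hW1, @norm_sub_sq ℂ, @norm_sub_sq ℂ, inner_smul_left, inner_smul_right, norm_smul,
      norm_smul, RCLike.norm_conj, shiftOp_norm]
    ring
  have hMiso : ∀ x, ‖(W * (↑u⁻¹ : H2 →L[ℂ] H2)) x‖ = ‖x‖ := fun x => by
    rw [mul_apply_eq_comp, hiso, hui]
  have hne : ∀ z : ℂ, ‖z‖ < 1 → 1 - ‖w‖ ≤ ‖1 - starRingEnd ℂ w * z‖ := by
    intro z hz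
    have h1 := norm_sub_norm_le (1 : ℂ) (starRingEnd ℂ w * z)
    rw [norm_mul, RCLike.norm_conj, norm_one] at h1
    nlinarith [norm_nonneg w, norm_nonneg z]
  refine ⟨W * (↑u⁻¹ : H2 →L[ℂ] H2), hMiso, ?_, ?_, ?_⟩
  · intro x z hz
    obtain ⟨y, rfl⟩ : ∃ y, (u : H2 →L[ℂ] H2) y = x := ⟨_, hui x⟩
    rw [mul_apply_eq_comp, hiu, hu1, hW1, fa_sub _ _ hz, fa_sub _ _ hz, fa_smul,
      fa_smul, fa_shift _ hz]
    have : 1 - starRingEnd ℂ w * z ≠ 0 := by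
      intro h
      have := hne z hz
      rw [h, norm_zero] at this
      linarith
    rw [div_mul_eq_mul_div, eq_div_iff this]
    ring
  · refine ⟨2 / (1 - ‖w‖), fun z hz => ?_⟩
    rw [norm_div]
    have : ‖w - z‖ ≤ 2 := (norm_sub_le _ _).trans (by linarith)
    exact div_le_div₀ (by norm_num) this (by linarith) (hne z hz)
  · refine rank_aux _ hMiso w (fun y => ⟨(u : H2 →L[ℂ] H2) y, ?_⟩)
    rw [mul_apply_eq_comp, hiu, hW1]

lemma good_pow (m : ℕ) : ∃ M, Good M (fun z => z ^ m) m := by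
  induction m with
  | zero => exact ⟨1, by simpa using good_one⟩
  | succ m ih =>
    obtain ⟨M, hM⟩ := ih
    exact ⟨_, by simpa [pow_succ] using hM.comp good_shift⟩

lemma good_prod (l : ℕ) (zs : Fin l → ℂ) (h : ∀ j, ‖zs j‖ < 1) :
    ∃ M, Good M (fun z => ∏ j, (zs j - z) / (1 - starRingEnd ℂ (zs j) * z)) l := by
  induction l with
  | zero => exact ⟨1, by simpa using good_one⟩
  | succ l ih =>
    obtain ⟨M, hM⟩ := ih (fun j => zs j.castSucc) (fun j => h _)
    obtain ⟨N, hN⟩ := good_blaschke (zs (Fin.last l)) (h _)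
    refine ⟨M * N, ?_⟩
    · simp only [Fin.prod_univ_castSucc]
      exact hM.comp hN

lemma parseval (c : ℕ → ℂ) (hc : Summable (fun k => ‖c k‖)) :
    HasSum (fun k => ‖c k‖ ^ 2) ((1 / (2 * Real.pi)) *
      ∫ t in Set.Icc (-Real.pi) Real.pi, ‖∑' k, c k * (Complex.exp (t * Complex.I)) ^ k‖ ^ 2) := by
  have : Fact (0 < 2 * Real.pi) := ⟨Real.two_pi_pos⟩
  have hs : Summable (fun k : ℕ => c k • (fourier (k : ℤ) : C(AddCircle (2 * Real.pi), ℂ))) := by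
    apply Summable.of_norm
    simpa [norm_smul, fourier_norm] using hc
  obtain ⟨g, hg⟩ := hs
  have hgv : ∀ t : ℝ, g (t : AddCircle (2 * Real.pi)) =
      ∑' k, c k * (Complex.exp (t * Complex.I)) ^ k := by
    intro t
    have h1 : HasSum (fun k : ℕ => (c k • (fourier (k : ℤ) : C(AddCircle (2 * Real.pi), ℂ)))
        (t : AddCircle (2 * Real.pi))) (g (t : AddCircle (2 * Real.pi))) :=
      hg.map (ContinuousMap.evalCLM ℂ (t : AddCircle (2 * Real.pi)))
        (ContinuousMap.evalCLM ℂ (t : AddCircle (2 * Real.pi))).continuous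
    rw [← h1.tsum_eq]
    congr 1; ext k
    rw [ContinuousMap.smul_apply, fourier_coe_apply, smul_eq_mul, ← Complex.exp_nat_mul]
    congr 2
    have : (Real.pi : ℂ) ≠ 0 := by exact_mod_cast Real.pi_ne_zero
    push_cast
    field_simp
  set v := ContinuousMap.toLp (E := ℂ) 2 (AddCircle.haarAddCircle (T := 2 * Real.pi)) ℂ g with hv
  have hv1 : HasSum (fun k : ℕ => c k • (fourierLp (T := 2 * Real.pi) 2 (k : ℤ))) v := by
    have := hg.mapL (ContinuousMap.toLp (E := ℂ) 2 (AddCircle.haarAddCircle (T := 2 * Real.pi)) ℂ)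
    simpa using this
  have horth := orthonormal_iff_ite.1 (orthonormal_fourier (T := 2 * Real.pi))
  have hj : ∀ j : ℕ, inner ℂ v (fourierLp (T := 2 * Real.pi) 2 (j : ℤ)) = starRingEnd ℂ (c j) := by
    intro j
    have h1 := hv1.mapL (innerSL ℂ (fourierLp (T := 2 * Real.pi) 2 (j : ℤ)))
    simp only [map_smul, innerSL_apply_apply, horth, smul_eq_mul] at h1
    have h2 : HasSum (fun k : ℕ => c k * if (j : ℤ) = (k : ℤ) then (1 : ℂ) else 0) (c j) := by
      convert hasSum_ite_eq j (c j) using 2 with k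
      by_cases hk : j = k
      · subst hk; simp
      · have hk2 : ¬ k = j := fun h => hk h.symm
        simp [hk, hk2]
    rw [← inner_conj_symm, h1.unique h2]
  have h3 := hv1.mapL (innerSL ℂ v)
  simp only [map_smul, innerSL_apply_apply, hj, smul_eq_mul] at h3
  have h4 : inner ℂ v v = ((‖v‖ ^ 2 : ℝ) : ℂ) := by
    rw [inner_self_eq_norm_sq_to_K]; simp
  have h5 : HasSum (fun k => ‖c k‖ ^ 2) (‖v‖ ^ 2) := by
    rw [h4] at h3
    rw [← Complex.hasSum_ofReal]
    simpa only [Complex.mul_conj, Complex.normSq_eq_norm_sq] using h3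
  have h6 : ‖v‖ ^ 2 = (1 / (2 * Real.pi)) *
      ∫ t in Set.Icc (-Real.pi) Real.pi, ‖∑' k, c k * (Complex.exp (t * Complex.I)) ^ k‖ ^ 2 := by
    have h7 : inner ℂ v v = _ := ContinuousMap.inner_toLp (𝕜 := ℂ) AddCircle.haarAddCircle g g
    have h8 : ∀ x, g x * starRingEnd ℂ (g x) = ((‖g x‖ ^ 2 : ℝ) : ℂ) := fun x => by
      rw [Complex.mul_conj, Complex.normSq_eq_norm_sq]
    rw [h4] at h7
    simp only [h8] at h7
    have h9 := Complex.ofReal_injective (h7.trans integral_complex_ofReal)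
    rw [h9, AddCircle.integral_haarAddCircle, smul_eq_mul, ← AddCircle.intervalIntegral_preimage (2 * Real.pi) (-Real.pi),
      intervalIntegral.integral_of_le (by linarith [Real.pi_pos]), integral_Icc_eq_integral_Ioc]
    simp only [hgv]
    rw [show -Real.pi + 2 * Real.pi = Real.pi by ring, one_div]
  rw [← h6]; exact h5

lemma cont_bdry {φ : ℂ → ℂ} (hφ_cont : ContinuousOn φ (Metric.closedBall 0 1)) (ρ : ℝ)
    (h0 : 0 ≤ ρ) (h1 : ρ ≤ 1) : Continuous (fun t : ℝ => φ (ρ * Complex.exp (t * Complex.I))) := by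
  apply hφ_cont.comp_continuous (by fun_prop)
  intro t
  simp [Complex.norm_exp_ofReal_mul_I, abs_of_nonneg h0, h1]

/-- The truncation -/
def FinSupp (a : H2) : Prop := ∃ N : ℕ, ∀ k, N ≤ k → a k = 0

lemma FinSupp.fa_eq {a : H2} (h : FinSupp a) : ∃ N : ℕ, ∀ z, fa a z = ∑ k ∈ Finset.range N, a k * z ^ k := by
  obtain ⟨N, hN⟩ := h
  refine ⟨N, fun z => tsum_eq_sum (fun k hk => ?_)⟩
  rw [hN k (by simpa using hk), zero_mul]

lemma FinSupp.cont {a : H2} (h : FinSupp a) : Continuous (fa a) := by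
  obtain ⟨N, hN⟩ := h.fa_eq
  have : fa a = _ := funext hN
  rw [this]; fun_prop

lemma FinSupp.sub {a b : H2} (ha : FinSupp a) (hb : FinSupp b) : FinSupp (a - b) := by
  obtain ⟨N, hN⟩ := ha
  obtain ⟨M, hM⟩ := hb
  refine ⟨max N M, fun k hk => ?_⟩
  simp [hN k (le_trans (le_max_left _ _) hk), hM k (le_trans (le_max_right _ _) hk)]

lemma finSupp_approx (a : H2) : ∃ p : ℕ → H2, (∀ k, FinSupp (p k)) ∧ Tendsto p atTop (nhds a) ∧
    ∀ z, ‖z‖ < 1 → Tendsto (fun k => fa (p k) z) atTop (nhds (fa a z)) := by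
  have h := (lp.hasSum_single (p := 2) (by norm_num) a).tendsto_sum_nat
  have hv : ∀ N k, (∑ i ∈ Finset.range N, lp.single 2 i (a i) : H2) k = if k < N then a k else 0 := by
    intro N k
    rw [lp.coeFn_sum, Finset.sum_apply]
    simp [Finset.sum_pi_single]
  refine ⟨_, fun N => ⟨N, fun k hk => ?_⟩, h, fun z hz => ?_⟩
  · rw [hv, if_neg (by omega)]
  · refine (fa_summable a hz).hasSum.tendsto_sum_nat.congr (fun N => ?_)
    unfold fa
    rw [tsum_eq_sum (s := Finset.range N)]
    · refine Finset.sum_congr rfl (fun k hk => ?_)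
      rw [hv, if_pos (by simpa using hk)]
    · intro k hk
      rw [hv, if_neg (by simpa using hk), zero_mul]

lemma norm_fin {φ : ℂ → ℂ}
    (hφ_cont : ContinuousOn φ (Metric.closedBall 0 1))
    (T : H2 →L[ℂ] H2)
    (hT : ∀ (a : H2) (z : ℂ), ‖z‖ < 1 → fa (T a) z = fa a (φ z))
    (a : H2) (ha : FinSupp a) :
    (1 / (2 * Real.pi)) * ∫ t in Set.Icc (-Real.pi) Real.pi,
      ‖fa a (φ (Complex.exp (t * Complex.I)))‖ ^ 2 = ‖T a‖ ^ 2 := by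
  have hG : ContinuousOn (fun z => fa a (φ z)) (Metric.closedBall 0 1) :=
    ha.cont.comp_continuousOn hφ_cont
  obtain ⟨C, hC⟩ := (isCompact_closedBall (0 : ℂ) 1).exists_bound_of_continuousOn hG
  have hmem : ∀ (ρ : ℝ), 0 ≤ ρ → ρ ≤ 1 → ∀ t : ℝ,
      (ρ : ℂ) * Complex.exp (t * Complex.I) ∈ Metric.closedBall (0 : ℂ) 1 := by
    intro ρ h0 h1 t
    simp [Complex.norm_exp_ofReal_mul_I, abs_of_nonneg h0, h1]
  let ρ : ℕ → ℝ := fun n => 1 - 1 / ((n : ℝ) + 1)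
  have hρ0 : ∀ n, 0 ≤ ρ n := fun n => by
    have : 1 / ((n : ℝ) + 1) ≤ 1 := by
      rw [div_le_one (by positivity)]; linarith [(Nat.cast_nonneg n : (0 : ℝ) ≤ n)]
    simp only [ρ]; linarith
  have hρ1 : ∀ n, ρ n < 1 := fun n => by
    have : 0 < 1 / ((n : ℝ) + 1) := by positivity
    simp only [ρ]; linarith
  have hρ : Tendsto ρ atTop (nhds 1) := by
    have h := (tendsto_one_div_add_atTop_nhds_zero_nat (𝕜 := ℝ)).const_sub 1
    rw [sub_zero] at h
    exact h
  have hid : ∀ n, (1 / (2 * Real.pi)) * ∫ t in Set.Icc (-Real.pi) Real.pi,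
      ‖fa a (φ (ρ n * Complex.exp (t * Complex.I)))‖ ^ 2 = ∑' k, ‖(T a) k‖ ^ 2 * (ρ n) ^ (2 * k) := by
    intro n
    have hn : ‖(ρ n : ℂ)‖ < 1 := by
      rw [Complex.norm_real, Real.norm_of_nonneg (hρ0 n)]; exact hρ1 n
    have h1 := parseval (fun k => (T a) k * (ρ n : ℂ) ^ k) (fa_summable_norm (T a) hn)
    have h2 := h1.tsum_eq
    have h3 : ∀ t : ℝ, fa a (φ (ρ n * Complex.exp (t * Complex.I))) =
        ∑' k, (T a) k * (ρ n : ℂ) ^ k * (Complex.exp (t * Complex.I)) ^ k := by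
      intro t
      rw [← hT]
      · unfold fa
        congr 1; ext k; rw [mul_pow, mul_assoc]
      · rw [norm_mul, Complex.norm_exp_ofReal_mul_I, mul_one]; exact hn
    simp only [h3]
    rw [← h2]
    congr 1; ext k
    rw [norm_mul, mul_pow, norm_pow, Complex.norm_real, Real.norm_of_nonneg (hρ0 n), ← pow_mul, mul_comm k 2]
  have hR : Tendsto (fun n => ∑' k, ‖(T a) k‖ ^ 2 * (ρ n) ^ (2 * k)) atTop (nhds (‖T a‖ ^ 2)) := by
    rw [← (h2_norm_sq (T a)).tsum_eq]
    refine tendsto_tsum_of_dominated_convergence (h2_norm_sq (T a)).summable (fun k => ?_)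
      (Eventually.of_forall fun n k => ?_)
    · simpa using (hρ.pow (2 * k)).const_mul (‖(T a) k‖ ^ 2)
    · rw [Real.norm_of_nonneg (mul_nonneg (sq_nonneg _) (pow_nonneg (hρ0 n) _))]
      exact mul_le_of_le_one_right (sq_nonneg _) (pow_le_one₀ (hρ0 n) (hρ1 n).le)
  have hL : Tendsto (fun n => (1 / (2 * Real.pi)) * ∫ t in Set.Icc (-Real.pi) Real.pi,
      ‖fa a (φ (ρ n * Complex.exp (t * Complex.I)))‖ ^ 2) atTop (nhds
      ((1 / (2 * Real.pi)) * ∫ t in Set.Icc (-Real.pi) Real.pi,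
      ‖fa a (φ (Complex.exp (t * Complex.I)))‖ ^ 2)) := by
    refine Tendsto.const_mul _ ?_
    refine tendsto_integral_of_dominated_convergence (fun _ => C ^ 2) (fun n => ?_)
      (integrable_const _) (fun n => Eventually.of_forall fun t => ?_)
      (Eventually.of_forall fun t => ?_)
    · exact (((ha.cont.comp (cont_bdry hφ_cont (ρ n) (hρ0 n) (hρ1 n).le)).norm).pow 2).aestronglyMeasurable
    · rw [Real.norm_of_nonneg (sq_nonneg _)]
      exact pow_le_pow_left₀ (norm_nonneg _) (hC _ (hmem _ (hρ0 n) (hρ1 n).le t)) 2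
    · have h1 := hG (Complex.exp (t * Complex.I)) (by simpa using hmem 1 zero_le_one le_rfl t)
      have h2 : Tendsto (fun n => (ρ n : ℂ) * Complex.exp (t * Complex.I)) atTop
          (nhdsWithin (Complex.exp (t * Complex.I)) (Metric.closedBall 0 1)) := by
        refine tendsto_nhdsWithin_iff.2 ⟨?_, Eventually.of_forall fun n => hmem _ (hρ0 n) (hρ1 n).le t⟩
        have : Tendsto (fun n => (ρ n : ℂ)) atTop (nhds ((1 : ℝ) : ℂ)) :=
          (Complex.continuous_ofReal.tendsto 1).comp hρ
        simpa using this.mul_const (Complex.exp (t * Complex.I))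
      exact ((h1.tendsto.comp h2).norm).pow 2
  simp only [hid] at hL
  exact tendsto_nhds_unique hL hR

lemma eLpNorm_sq_eq {α : Type*} [MeasurableSpace α] {μ : Measure α} {f : α → ℂ} (hf : MemLp f 2 μ) :
    eLpNorm f 2 μ = ENNReal.ofReal (Real.sqrt (∫ t, ‖f t‖ ^ 2 ∂μ)) := by
  rw [hf.eLpNorm_eq_integral_rpow_norm (by norm_num) (by norm_num), Real.sqrt_eq_rpow]
  simp

lemma norm_general {φ : ℂ → ℂ}
    (hφ_cont : ContinuousOn φ (Metric.closedBall 0 1))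
    (hφ_bdry : ∀ t : ℝ, ‖φ (Complex.exp (t * Complex.I))‖ ≤ 1)
    (hφ_null : volume {t : ℝ | t ∈ Set.Icc (-Real.pi) Real.pi ∧
      ‖φ (Complex.exp (t * Complex.I))‖ = 1} = 0)
    (T : H2 →L[ℂ] H2)
    (hT : ∀ (a : H2) (z : ℂ), ‖z‖ < 1 → fa (T a) z = fa a (φ z)) (a : H2) :
    IntegrableOn (fun t : ℝ => ‖fa a (φ (Complex.exp (t * Complex.I)))‖ ^ 2)
      (Set.Icc (-Real.pi) Real.pi) ∧
    (1 / (2 * Real.pi)) * ∫ t in Set.Icc (-Real.pi) Real.pi,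
      ‖fa a (φ (Complex.exp (t * Complex.I)))‖ ^ 2 = ‖T a‖ ^ 2 := by
  set μ : Measure ℝ := volume.restrict (Set.Icc (-Real.pi) Real.pi) with hμ
  set γ : ℝ → ℂ := fun t => φ (Complex.exp (t * Complex.I)) with hγ
  have hγc : Continuous γ := by
    simpa using cont_bdry hφ_cont 1 zero_le_one le_rfl
  have hae : ∀ᵐ t ∂μ, ‖γ t‖ < 1 := by
    rw [hμ, ae_restrict_iff' measurableSet_Icc]
    rw [ae_iff]
    refine measure_mono_null (fun t ht => ?_) hφ_null
    simp only [Set.mem_setOf_eq, Classical.not_imp, not_lt] at ht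
    exact ⟨ht.1, le_antisymm (hφ_bdry t) ht.2⟩
  set q : ℝ := Real.sqrt (2 * Real.pi) with hq
  have hq0 : 0 < q := Real.sqrt_pos.2 Real.two_pi_pos
  have hfinL : ∀ b : H2, FinSupp b → MemLp (fun t => fa b (γ t)) 2 μ := by
    intro b hb
    obtain ⟨C, hC⟩ := (isCompact_Icc (a := -Real.pi) (b := Real.pi)).exists_bound_of_continuousOn
      (hb.cont.comp hγc).continuousOn
    refine MemLp.of_bound (hb.cont.comp hγc).aestronglyMeasurable C ?_
    rw [hμ, ae_restrict_iff' measurableSet_Icc]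
    exact Eventually.of_forall fun t ht => hC t ht
  have hfin : ∀ b : H2, FinSupp b →
      eLpNorm (fun t => fa b (γ t)) 2 μ = ENNReal.ofReal (q * ‖T b‖) := by
    intro b hb
    rw [eLpNorm_sq_eq (hfinL b hb)]
    congr 1
    have h := norm_fin hφ_cont T hT b hb
    have h2 : ∫ t, ‖fa b (γ t)‖ ^ 2 ∂μ = (2 * Real.pi) * ‖T b‖ ^ 2 := by
      rw [← h]
      have := Real.two_pi_pos.ne'
      field_simp
      rfl
    rw [h2, Real.sqrt_mul Real.two_pi_pos.le, Real.sqrt_sq (norm_nonneg _)]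
  obtain ⟨p, hpf, hpt, hpz⟩ := finSupp_approx a
  have hTp : Tendsto (fun k => T (p k)) atTop (nhds (T a)) := (T.continuous.tendsto a).comp hpt
  have hlim : ∀ᵐ t ∂μ, Tendsto (fun k => fa (p k) (γ t)) atTop (nhds (fa a (γ t))) := by
    filter_upwards [hae] with t ht using hpz _ ht
  have hmeas : AEStronglyMeasurable (fun t => fa a (γ t)) μ :=
    aestronglyMeasurable_of_tendsto_ae atTop
      (fun k => ((hpf k).cont.comp hγc).aestronglyMeasurable) hlim
  have hN : Tendsto (fun k => ENNReal.ofReal (q * ‖T (p k)‖)) atTop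
      (nhds (ENNReal.ofReal (q * ‖T a‖))) :=
    ENNReal.tendsto_ofReal (hTp.norm.const_mul q)
  have hle : eLpNorm (fun t => fa a (γ t)) 2 μ ≤ ENNReal.ofReal (q * ‖T a‖) := by
    refine (Lp.eLpNorm_lim_le_liminf_eLpNorm
      (fun k => ((hpf k).cont.comp hγc).aestronglyMeasurable) _ hlim).trans ?_
    have : (fun k => eLpNorm (fun t => fa (p k) (γ t)) 2 μ) =
      fun k => ENNReal.ofReal (q * ‖T (p k)‖) := funext fun k => hfin _ (hpf k)
    exact (congrArg (fun u => liminf u atTop) this).le.trans hN.liminf_eq.le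
  have hdiff : ∀ k, eLpNorm (fun t => fa a (γ t) - fa (p k) (γ t)) 2 μ ≤
      ENNReal.ofReal (q * ‖T a - T (p k)‖) := by
    intro k
    have hN' : Tendsto (fun l => ENNReal.ofReal (q * ‖T (p l) - T (p k)‖)) atTop
        (nhds (ENNReal.ofReal (q * ‖T a - T (p k)‖))) :=
      ENNReal.tendsto_ofReal ((hTp.sub_const _).norm.const_mul q)
    have hlim' : ∀ᵐ t ∂μ, Tendsto (fun l => fa (p l) (γ t) - fa (p k) (γ t)) atTop
        (nhds (fa a (γ t) - fa (p k) (γ t))) := by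
      filter_upwards [hlim] with t ht using ht.sub_const _
    refine (Lp.eLpNorm_lim_le_liminf_eLpNorm
      (fun l => (((hpf l).cont.comp hγc).sub ((hpf k).cont.comp hγc)).aestronglyMeasurable)
        _ hlim').trans ?_
    have : (fun l => eLpNorm (fun t => fa (p l) (γ t) - fa (p k) (γ t)) 2 μ) =
      fun l => ENNReal.ofReal (q * ‖T (p l) - T (p k)‖) := funext fun l => by
        rw [← map_sub, ← hfin _ ((hpf l).sub (hpf k))]
        refine eLpNorm_congr_ae ?_
        filter_upwards [hae] with t ht
        rw [fa_sub _ _ ht]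
    exact (congrArg (fun u => liminf u atTop) this).le.trans hN'.liminf_eq.le
  have hge : ENNReal.ofReal (q * ‖T a‖) ≤ eLpNorm (fun t => fa a (γ t)) 2 μ := by
    have hk : ∀ k, ENNReal.ofReal (q * ‖T (p k)‖) ≤
        eLpNorm (fun t => fa a (γ t)) 2 μ + ENNReal.ofReal (q * ‖T a - T (p k)‖) := by
      intro k
      rw [← hfin _ (hpf k)]
      have h1 : (fun t => fa (p k) (γ t)) =
        (fun t => fa a (γ t)) - (fun t => fa a (γ t) - fa (p k) (γ t)) := by
        ext t; simp
      rw [h1]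
      refine (eLpNorm_sub_le hmeas (hmeas.sub ((hpf k).cont.comp hγc).aestronglyMeasurable)
        (by norm_num)).trans ?_
      gcongr
      exact hdiff k
    have h0 : Tendsto (fun k => ENNReal.ofReal (q * ‖T a - T (p k)‖)) atTop (nhds 0) := by
      have h := ENNReal.tendsto_ofReal ((hTp.const_sub (T a)).norm.const_mul q)
      simpa using h
    have h2 := tendsto_const_nhds (x := eLpNorm (fun t => fa a (γ t)) 2 μ) (f := atTop (α := ℕ)) |>.add h0
    rw [add_zero] at h2
    exact le_of_tendsto_of_tendsto' hN h2 hk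
  have hmem : MemLp (fun t => fa a (γ t)) 2 μ := ⟨hmeas, hle.trans_lt ENNReal.ofReal_lt_top⟩
  have hint : Integrable (fun t => ‖fa a (γ t)‖ ^ 2) μ := hmem.integrable_norm_pow (by norm_num)
  refine ⟨hint, ?_⟩
  have heq := le_antisymm hle hge
  rw [eLpNorm_sq_eq hmem, ENNReal.ofReal_eq_ofReal_iff (Real.sqrt_nonneg _) (by positivity)] at heq
  have h3 : ∫ t, ‖fa a (γ t)‖ ^ 2 ∂μ = (2 * Real.pi) * ‖T a‖ ^ 2 := by
    rw [← Real.sq_sqrt (integral_nonneg (f := fun t => ‖fa a (γ t)‖ ^ 2) (μ := μ) fun t => sq_nonneg _), heq, mul_pow, hq,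
      Real.sq_sqrt Real.two_pi_pos.le]
  rw [h3]
  have := Real.two_pi_pos.ne'
  field_simp

theorem stmt4 (φ : ℂ → ℂ)
    (hφ_cont : ContinuousOn φ (Metric.closedBall 0 1))
    (hφ_diff : DifferentiableOn ℂ φ (Metric.ball 0 1))
    (hφ_maps : Set.MapsTo φ (Metric.ball 0 1) (Metric.ball 0 1))
    (hφ_bdry : ∀ t : ℝ, ‖φ (Complex.exp (t * Complex.I))‖ ≤ 1)
    (hφ_null : volume {t : ℝ | t ∈ Set.Icc (-Real.pi) Real.pi ∧
      ‖φ (Complex.exp (t * Complex.I))‖ = 1} = 0)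
    (T : H2 →L[ℂ] H2)
    (hT : ∀ (a : H2) (z : ℂ), ‖z‖ < 1 → fa (T a) z = fa a (φ z))
    (n : ℕ) (hn : 1 ≤ n)
    (m : ℕ) (hm : m ≤ n - 1)
    (zs : Fin (n - 1 - m) → ℂ)
    (hzs : ∀ j, zs j ∈ Metric.ball (0 : ℂ) 1 ∧ zs j ≠ 0)
    (B : ℂ → ℂ)
    (hB : ∀ z : ℂ, B z = z ^ m *
      ∏ j : Fin (n - 1 - m), (zs j - z) / (1 - (starRingEnd ℂ) (zs j) * z))
    (r : ℝ) (hr₀ : 0 < r) (hr₁ : r < 1)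
    (K : ℝ) (hK₀ : 0 ≤ K)
    (hK : ∀ a : H2,
      (1 / (2 * Real.pi)) *
        ∫ t in {t : ℝ | t ∈ Set.Icc (-Real.pi) Real.pi ∧
            r < ‖φ (Complex.exp (t * Complex.I))‖ ∧
            ‖φ (Complex.exp (t * Complex.I))‖ < 1},
          ‖fa a (φ (Complex.exp (t * Complex.I)))‖ ^ 2
        ≤ K * ‖a‖ ^ 2) :
    approxNum T n ≤
      Real.sqrt
        ((sSup {s : ℝ | ∃ t ∈ Set.Icc (-Real.pi) Real.pi,
            ‖φ (Complex.exp (t * Complex.I))‖ ≤ r ∧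
            s = ‖B (φ (Complex.exp (t * Complex.I)))‖}) ^ 2 * ‖T‖ ^ 2 + K) := by
  obtain ⟨M₁, hM₁⟩ := good_pow m
  obtain ⟨M₂, hM₂⟩ := good_prod (n - 1 - m) zs (fun j => by simpa using (hzs j).1)
  have hM := hM₁.comp hM₂
  rw [show m + (n - 1 - m) = n - 1 by omega] at hM
  have hBe : (fun z : ℂ => z ^ m * ∏ j : Fin (n - 1 - m),
    (zs j - z) / (1 - (starRingEnd ℂ) (zs j) * z)) = B := funext fun z => (hB z).symm
  rw [hBe] at hM
  set M := M₁ * M₂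
  set γ : ℝ → ℂ := fun t => φ (Complex.exp (t * Complex.I)) with hγ
  have hγc : Continuous γ := by
    simpa using cont_bdry hφ_cont 1 zero_le_one le_rfl
  set Ss : Set ℝ := {s : ℝ | ∃ t ∈ Set.Icc (-Real.pi) Real.pi,
            ‖φ (Complex.exp (t * Complex.I))‖ ≤ r ∧
            s = ‖B (φ (Complex.exp (t * Complex.I)))‖} with hSs
  have hbdd : BddAbove Ss := by
    obtain ⟨C, hC⟩ := hM.bdd
    refine ⟨C, ?_⟩
    rintro s ⟨t, ht, htr, rfl⟩
    exact hC _ (htr.trans_lt hr₁)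
  set S := sSup Ss with hS
  have hS0 : 0 ≤ S := Real.sSup_nonneg (by rintro s ⟨t, ht, htr, rfl⟩; exact norm_nonneg _)
  -- the main estimate
  have key : ∀ g : H2, ‖T (M g)‖ ^ 2 ≤ (S ^ 2 * ‖T‖ ^ 2 + K) * ‖g‖ ^ 2 := by
    intro g
    obtain ⟨hi1, he1⟩ := norm_general hφ_cont hφ_bdry hφ_null T hT (M g)
    obtain ⟨hi2, he2⟩ := norm_general hφ_cont hφ_bdry hφ_null T hT g
    have hKg := hK (M g)
    rw [hM.iso] at hKg
    set E1 : Set ℝ := {t : ℝ | t ∈ Set.Icc (-Real.pi) Real.pi ∧ ‖γ t‖ ≤ r} with hE1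
    set E2 : Set ℝ := {t : ℝ | t ∈ Set.Icc (-Real.pi) Real.pi ∧
            r < ‖φ (Complex.exp (t * Complex.I))‖ ∧
            ‖φ (Complex.exp (t * Complex.I))‖ < 1} with hE2
    have hE1m : MeasurableSet E1 :=
      measurableSet_Icc.inter (measurableSet_le hγc.norm.measurable measurable_const)
    have hE2m : MeasurableSet E2 :=
      measurableSet_Icc.inter ((measurableSet_lt measurable_const hγc.norm.measurable).inter
        (measurableSet_lt hγc.norm.measurable measurable_const))
    have hE1s : E1 ⊆ Set.Icc (-Real.pi) Real.pi := fun t ht => ht.1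
    have hE2s : E2 ⊆ Set.Icc (-Real.pi) Real.pi := fun t ht => ht.1
    have hdisj : Disjoint E1 E2 := by
      rw [Set.disjoint_left]
      intro t h1 h2
      exact absurd h1.2 (not_le.2 h2.2.1)
    have hae : (Set.Icc (-Real.pi) Real.pi : Set ℝ) =ᵐ[volume] (E1 ∪ E2 : Set ℝ) := by
      refine (ae_le_set.2 ?_).antisymm (Set.union_subset hE1s hE2s).eventuallyLE
      refine measure_mono_null (fun t ht => ?_) hφ_null
      refine ⟨ht.1, le_antisymm (hφ_bdry t) ?_⟩
      by_contra h
      refine ht.2 ?_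
      by_cases hr : ‖γ t‖ ≤ r
      · exact Or.inl ⟨ht.1, hr⟩
      · exact Or.inr ⟨ht.1, not_le.1 hr, not_le.1 h⟩
    rw [setIntegral_congr_set hae, setIntegral_union hdisj hE2m (hi1.mono_set hE1s)
      (hi1.mono_set hE2s), mul_add] at he1
    have h1 : ∫ t in E1, ‖fa (M g) (φ (Complex.exp (t * Complex.I)))‖ ^ 2 ≤
        S ^ 2 * ∫ t in Set.Icc (-Real.pi) Real.pi, ‖fa g (φ (Complex.exp (t * Complex.I)))‖ ^ 2 := by
      calc _ ≤ ∫ t in E1, S ^ 2 * ‖fa g (φ (Complex.exp (t * Complex.I)))‖ ^ 2 := by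
            refine setIntegral_mono_on (hi1.mono_set hE1s) ((hi2.mono_set hE1s).const_mul _)
              hE1m (fun t ht => ?_)
            rw [hM.mul _ _ (ht.2.trans_lt hr₁), norm_mul, mul_pow]
            gcongr
            exact le_csSup hbdd ⟨t, ht.1, ht.2, rfl⟩
        _ = S ^ 2 * ∫ t in E1, ‖fa g (φ (Complex.exp (t * Complex.I)))‖ ^ 2 :=
            integral_const_mul _ _
        _ ≤ _ := by
            refine mul_le_mul_of_nonneg_left ?_ (sq_nonneg S)
            exact setIntegral_mono_set hi2 (Eventually.of_forall fun t => sq_nonneg _)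
              hE1s.eventuallyLE
    have h2 : (1 / (2 * Real.pi)) * ∫ t in E1, ‖fa (M g) (φ (Complex.exp (t * Complex.I)))‖ ^ 2 ≤
        S ^ 2 * ‖T g‖ ^ 2 := by
      rw [← he2, mul_left_comm]
      have := Real.pi_pos
      gcongr
    have h3 : ‖T g‖ ^ 2 ≤ ‖T‖ ^ 2 * ‖g‖ ^ 2 := by
      rw [← mul_pow]
      exact pow_le_pow_left₀ (norm_nonneg _) (T.le_opNorm g) 2
    have h4 : S ^ 2 * ‖T g‖ ^ 2 ≤ S ^ 2 * (‖T‖ ^ 2 * ‖g‖ ^ 2) := by gcongr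
    rw [← he1]
    linarith
  set P : H2 →L[ℂ] H2 := 1 - M * ContinuousLinearMap.adjoint M with hP
  have hrank : LinearMap.rank ((T * P : H2 →L[ℂ] H2) : H2 →ₗ[ℂ] H2) ≤ ((n - 1 : ℕ) : Cardinal) :=
    (LinearMap.rank_comp_le_right _ _).trans hM.rank
  have hnorm : ‖T - T * P‖ ≤ Real.sqrt (S ^ 2 * ‖T‖ ^ 2 + K) := by
    have hadj : ‖ContinuousLinearMap.adjoint M‖ ≤ 1 := by
      rw [LinearIsometryEquiv.norm_map]
      exact M.opNorm_le_bound zero_le_one (fun x => by rw [hM.iso, one_mul])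
    refine ContinuousLinearMap.opNorm_le_bound _ (Real.sqrt_nonneg _) (fun x => ?_)
    have h1 : (T - T * P) x = T (M (ContinuousLinearMap.adjoint M x)) := by
      simp [hP]
    have h2 : ‖ContinuousLinearMap.adjoint M x‖ ≤ ‖x‖ :=
      (ContinuousLinearMap.le_of_opNorm_le _ hadj x).trans (by rw [one_mul])
    rw [h1]
    refine le_trans ?_ (mul_le_mul_of_nonneg_left h2 (Real.sqrt_nonneg _))
    refine (abs_le_of_sq_le_sq' ?_ (by positivity)).2
    rw [mul_pow, Real.sq_sqrt (by positivity)]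
    exact key _
  refine le_trans (csInf_le ⟨0, ?_⟩ ⟨T * P, ?_, ?_, rfl⟩) hnorm
  · rintro c ⟨R, -, -, rfl⟩
    exact norm_nonneg _
  · exact Module.rank_lt_aleph0_iff.1 (hrank.trans_lt Cardinal.natCast_lt_aleph0)
  · exact Module.finrank_le_of_rank_le hrank

end
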